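/- arXiv:2109.02010 — 3 statements merged into one kernel-verified Lean document; each statement's English description precedes it below -/
import Mathlib

section
/- If x is a harmonic bounded operator on F, then for every word I : List Θ the composition x r_I is harmonic: P_ω(x ∘ r_I) = x ∘ r_I. Consequently P_ω^n(x r_I) = x r_I for every n ≥ 0, so the sequence (P_ω^n(x r_I)) converges in SOT to x r_I (the Choi–Effros product x ∘ r_I equals the operator product x r_I). -/
open Filter Topology

noncomputable section

/-- The full Fock space over a Hilbert space with orthonormal basis indexed by `Θ`,
realized as `ℓ²(List Θ)`. -/
abbrev Fock (Θ : Type*) : Type _ := lp (fun _ : List Θ => ℂ) 2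

/-- The canonical orthonormal basis vector `e_I` of the Fock space, indexed by a word
`I : List Θ`.  The vacuum vector is `Ω = fockBasis []`. -/
noncomputable def fockBasis {Θ : Type*} [DecidableEq Θ] (I : List Θ) : Fock Θ :=
  lp.single 2 I 1

/-- For a word `I = [i₁, …, i_k]`, `wordOp r I = r i₁ ∘L ⋯ ∘L r i_k`, the identity for the
empty word.  Applied to the right (resp. left) creation operators, this gives `r_I`
(resp. `l_I`). -/
noncomputable def wordOp {Θ : Type*} (r : Θ → Fock Θ →L[ℂ] Fock Θ) :
    List Θ → (Fock Θ →L[ℂ] Fock Θ)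
  | [] => 1
  | i :: I => r i ∘L wordOp r I

/-- Two bounded operators agreeing on the canonical basis are equal. -/
theorem fock_ext {Θ : Type*} [DecidableEq Θ] {A B : Fock Θ →L[ℂ] Fock Θ}
    (h : ∀ I, A (fockBasis I) = B (fockBasis I)) : A = B := by
  ext1 v
  have hs := lp.hasSum_single (E := fun _ : List Θ => ℂ) (p := 2) (by norm_num) v
  have key : ∀ I : List Θ,
      A (lp.single 2 I (v I) : Fock Θ) = B (lp.single 2 I (v I) : Fock Θ) := by
    intro I
    have e : (lp.single 2 I (v I) : Fock Θ) = (v I) • fockBasis I := by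
      unfold fockBasis
      rw [← lp.single_smul]
      simp
    rw [e, map_smul, map_smul, h]
  have hA := A.hasSum hs
  have hB := B.hasSum hs
  have : (fun I : List Θ => A (lp.single 2 I (v I) : Fock Θ)) =
      fun I : List Θ => B (lp.single 2 I (v I) : Fock Θ) := funext key
  rw [this] at hA
  exact hA.unique hB

/-- If `x` is harmonic then `x ∘ r_I` is harmonic, `P_ω^n (x r_I) = x r_I` for
all `n`, and `(P_ω^n (x r_I))` converges in SOT to `x r_I` (so the Choi–Effros product
`x ∘ r_I` is the operator product). -/
theorem statement3 {Θ : Type*} [Countable Θ] [Nonempty Θ] [DecidableEq Θ]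
    (l r : Θ → Fock Θ →L[ℂ] Fock Θ)
    (hl : ∀ (i : Θ) (I : List Θ), l i (fockBasis I) = fockBasis (i :: I))
    (hr : ∀ (i : Θ) (I : List Θ), r i (fockBasis I) = fockBasis (I ++ [i]))
    (ω : Θ → ℝ) (hω : ∀ i, 0 < ω i) (hω1 : ∑' i, ω i = 1)
    (P : (Fock Θ →L[ℂ] Fock Θ) → (Fock Θ →L[ℂ] Fock Θ))
    (hP : ∀ (x : Fock Θ →L[ℂ] Fock Θ) (v : Fock Θ),
      P x v = ∑' i, (ω i : ℂ) • ((ContinuousLinearMap.adjoint (l i) ∘L x ∘L l i) v))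
    (x : Fock Θ →L[ℂ] Fock Θ) (hx : P x = x) (I : List Θ) :
    P (x ∘L wordOp r I) = x ∘L wordOp r I ∧
    (∀ n : ℕ, P^[n] (x ∘L wordOp r I) = x ∘L wordOp r I) ∧
    (∀ v : Fock Θ, Tendsto (fun n : ℕ => (P^[n] (x ∘L wordOp r I)) v) atTop
      (𝓝 ((x ∘L wordOp r I) v))) := by
  have comm1 : ∀ i j, r j ∘L l i = l i ∘L r j := by
    intro i j
    apply fock_ext
    intro J
    simp [hl, hr]
  have comm : ∀ i (J : List Θ) (v : Fock Θ), wordOp r J (l i v) = l i (wordOp r J v) := by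
    intro i J
    induction J with
    | nil => intro v; simp [wordOp]
    | cons j J ih =>
      intro v
      have := congrArg (fun T : Fock Θ →L[ℂ] Fock Θ => T (wordOp r J v)) (comm1 i j)
      simpa [wordOp, ih] using this
  have h1 : P (x ∘L wordOp r I) = x ∘L wordOp r I := by
    ext1 v
    have h2 := hP x (wordOp r I v)
    rw [hx] at h2
    rw [hP, ContinuousLinearMap.comp_apply, h2]
    simp only [ContinuousLinearMap.comp_apply, comm]
  have h3 : ∀ n : ℕ, P^[n] (x ∘L wordOp r I) = x ∘L wordOp r I :=
    fun n => Function.iterate_fixed h1 n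
  refine ⟨h1, h3, fun v => ?_⟩
  simp only [h3]
  exact tendsto_const_nhds
end
end

section
/- Fix a real number λ with 0 < λ < 1 and a natural number n ≥ 1. The following are equivalent: (1) there exist natural numbers k₁, …, k_n ≥ 1 with gcd(k₁, …, k_n) = 1 and λ^{k₁} + ⋯ + λ^{k_n} = 1; (2) there exist real numbers c₁, …, c_n ∈ (0, 1) with c₁ + ⋯ + c_n = 1 such that { λ^m : m ∈ ℤ } = { c_I / c_J : I, J ∈ List (Fin n) }, where for a word I = [i₁, …, i_k] one sets c_I := c_{i₁} ⋯ c_{i_k} (and c of the empty word is 1), and λ^m denotes the integer power (zpow). -/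
theorem aux_prod (lam : ℝ) (n : ℕ) (k : Fin n → ℕ) (I : List (Fin n)) :
    (I.map (fun i => lam ^ k i)).prod = lam ^ (I.map k).sum := by
  induction I with
  | nil => simp
  | cons a t ih => simp [ih, pow_add]

theorem aux_dvd (n : ℕ) (k : Fin n → ℕ) (d : ℕ) (hd : ∀ i, d ∣ k i) (I : List (Fin n)) :
    d ∣ (I.map k).sum := by
  induction I with
  | nil => simp
  | cons a t ih => simpa using dvd_add (hd a) ih

theorem aux_quot (lam : ℝ) (h0 : 0 < lam) (n : ℕ) (k : Fin n → ℕ) (I J : List (Fin n)) :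
    (I.map (fun i => lam ^ k i)).prod / (J.map (fun i => lam ^ k i)).prod
      = lam ^ (((I.map k).sum : ℤ) - ((J.map k).sum : ℤ)) := by
  rw [aux_prod, aux_prod, zpow_sub₀ h0.ne', zpow_natCast, zpow_natCast]

/-- The group of differences of word weights. -/
def auxS (n : ℕ) (k : Fin n → ℕ) : AddSubgroup ℤ where
  carrier := {m | ∃ I J : List (Fin n), m = ((I.map k).sum : ℤ) - ((J.map k).sum : ℤ)}
  zero_mem' := ⟨[], [], by simp⟩
  add_mem' := by
    rintro _ _ ⟨I, J, rfl⟩ ⟨I', J', rfl⟩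
    refine ⟨I ++ I', J ++ J', ?_⟩
    simp only [List.map_append, List.sum_append]
    push_cast
    ring
  neg_mem' := by
    rintro _ ⟨I, J, rfl⟩
    exact ⟨J, I, by ring⟩

theorem auxS_all (n : ℕ) (k : Fin n → ℕ) (hg : Finset.univ.gcd k = 1) (m : ℤ) :
    m ∈ auxS n k := by
  obtain ⟨d, hd⟩ := Int.subgroup_cyclic (auxS n k)
  have hdk : ∀ i, d.natAbs ∣ k i := by
    intro i
    have hi : (k i : ℤ) ∈ auxS n k := ⟨[i], [], by simp⟩
    rw [hd, AddSubgroup.mem_closure_singleton] at hi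
    obtain ⟨z, hz⟩ := hi
    rw [← Int.natCast_dvd_natCast, Int.natAbs_dvd]
    exact ⟨z, by rw [← hz, smul_eq_mul, mul_comm]⟩
  have h : d.natAbs ∣ Finset.univ.gcd k := Finset.dvd_gcd (fun i _ => hdk i)
  rw [hg, ← Int.natCast_dvd_natCast, Int.natAbs_dvd] at h
  obtain ⟨e, he⟩ := h
  rw [hd, AddSubgroup.mem_closure_singleton]
  refine ⟨m * e, ?_⟩
  have he' : d * e = 1 := by rw [← he]; simp
  rw [smul_eq_mul, mul_assoc, mul_comm e d, he', mul_one]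

/-- For `0 < λ < 1` and `n ≥ 1`, the following are equivalent:
(1) there are `k₁, …, k_n ≥ 1` with `gcd(k₁,…,k_n) = 1` and `λ^{k₁} + ⋯ + λ^{k_n} = 1`;
(2) there are `c₁, …, c_n ∈ (0,1)` with `c₁ + ⋯ + c_n = 1` and
`{λ^m : m ∈ ℤ} = {c_I / c_J : I, J words over Fin n}`, where `c_I` denotes the product of
the `c_i` over the letters of `I` (equal to `1` for the empty word). -/
theorem statement16 (lam : ℝ) (h0 : 0 < lam) (h1 : lam < 1) (n : ℕ) (hn : 1 ≤ n) :
    (∃ k : Fin n → ℕ, (∀ i, 1 ≤ k i) ∧ Finset.univ.gcd k = 1 ∧ ∑ i, lam ^ k i = 1) ↔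
    (∃ c : Fin n → ℝ, (∀ i, 0 < c i ∧ c i < 1) ∧ ∑ i, c i = 1 ∧
      {x : ℝ | ∃ m : ℤ, x = lam ^ m}
        = {x : ℝ | ∃ I J : List (Fin n), x = (I.map c).prod / (J.map c).prod}) := by
  constructor
  · rintro ⟨k, hk, hg, hs⟩
    refine ⟨fun i => lam ^ k i, fun i => ⟨pow_pos h0 _, pow_lt_one₀ h0.le h1 ?_⟩, hs, ?_⟩
    · have := hk i
      omega
    · ext x
      constructor
      · rintro ⟨m, rfl⟩
        obtain ⟨I, J, h⟩ := auxS_all n k hg m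
        exact ⟨I, J, by rw [aux_quot lam h0, h]⟩
      · rintro ⟨I, J, rfl⟩
        exact ⟨_, aux_quot lam h0 n k I J⟩
  · rintro ⟨c, hc, hs, he⟩
    have hk : ∀ i, ∃ k : ℕ, 1 ≤ k ∧ c i = lam ^ k := by
      intro i
      have hi : c i ∈ {x : ℝ | ∃ m : ℤ, x = lam ^ m} := by
        rw [he]
        exact ⟨[i], [], by simp⟩
      obtain ⟨m, hm⟩ := hi
      have hpos : 0 < m := by
        by_contra hneg
        have h2 := one_le_zpow_of_nonpos₀ h0 h1.le (not_lt.mp hneg)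
        have h3 := (hc i).2
        linarith
      lift m to ℕ using hpos.le
      exact ⟨m, by omega, by simpa using hm⟩
    choose k hk1 hk2 using hk
    obtain rfl : c = fun i => lam ^ k i := funext hk2
    refine ⟨k, hk1, ?_, hs⟩
    have hl : lam ∈ {x : ℝ | ∃ m : ℤ, x = lam ^ m} := ⟨1, by simp⟩
    rw [he] at hl
    obtain ⟨I, J, h⟩ := hl
    rw [aux_quot lam h0] at h
    have h' := zpow_right_injective₀ h0 h1.ne ((zpow_one lam).trans h)
    have hd : ∀ i, Finset.univ.gcd k ∣ k i := fun i => Finset.gcd_dvd (Finset.mem_univ i)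
    have hI := Int.natCast_dvd_natCast.mpr (aux_dvd n k _ hd I)
    have hJ := Int.natCast_dvd_natCast.mpr (aux_dvd n k _ hd J)
    have h3 := dvd_sub hI hJ
    rw [← h'] at h3
    exact Nat.dvd_one.mp (by exact_mod_cast h3)
end

section
/- Let Θ be a countable type with at least two elements and let ω : Θ → ℝ satisfy ω i > 0 for all i and ∑' i, ω i = 1 (so that 0 < ω i < 1 for every i). Fix k ∈ Θ and set t₀ := (Real.log (ω k))⁻¹, which is a nonzero real number. Then ∑' i, (ω i : ℂ) ^ ((1 : ℂ) + t₀ * Complex.I) ≠ 1; equivalently, ∑' i, ω i * (1 − Real.cos (Real.log (ω i) / Real.log (ω k))) > 0. (This is the key step showing the Poisson boundary H^∞(B(F), P_ω) is a type III factor: there exists a nonzero t ∈ ℝ with ∑_i ω_i^{1+it} ≠ 1.) -/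
/-- Let `Θ` be countable with at least two elements and let `ω : Θ → ℝ`
satisfy `ω i > 0` and `∑' i, ω i = 1`.  Fix `k ∈ Θ` and set `t₀ := (log (ω k))⁻¹`.  Then
`t₀ ≠ 0`, `∑' i, (ω i : ℂ) ^ (1 + t₀·I) ≠ 1`, and equivalently
`∑' i, ω i * (1 − cos (log (ω i) / log (ω k))) > 0`.  (Key step in the proof that the
Poisson boundary is a type III factor.) -/
theorem statement19 {Θ : Type*} [Countable Θ] [Nontrivial Θ]
    (ω : Θ → ℝ) (hω : ∀ i, 0 < ω i) (hω1 : ∑' i, ω i = 1)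
    (k : Θ) (t₀ : ℝ) (ht₀ : t₀ = (Real.log (ω k))⁻¹) :
    t₀ ≠ 0 ∧
    (∑' i, (ω i : ℂ) ^ ((1 : ℂ) + (t₀ : ℂ) * Complex.I)) ≠ 1 ∧
    0 < ∑' i, ω i * (1 - Real.cos (Real.log (ω i) / Real.log (ω k))) := by
  have hs : Summable ω := by
    by_contra h
    rw [tsum_eq_zero_of_not_summable h] at hω1
    exact zero_ne_one hω1
  have hk1 : ω k < 1 := by
    obtain ⟨j, hj⟩ := exists_ne k
    classical
    have h := hs.sum_le_tsum {k, j} (fun i _ => (hω i).le)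
    rw [Finset.sum_pair hj.symm, hω1] at h
    linarith [hω j]
  have hlog : Real.log (ω k) ≠ 0 := (Real.log_neg (hω k) hk1).ne
  have hnorm : ∀ i, ‖(ω i : ℂ) ^ ((1 : ℂ) + (t₀ : ℂ) * Complex.I)‖ = ω i := by
    intro i
    rw [Complex.norm_cpow_eq_rpow_re_of_pos (hω i)]
    simp
  have hre : ∀ i, ((ω i : ℂ) ^ ((1 : ℂ) + (t₀ : ℂ) * Complex.I)).re
      = ω i * Real.cos (Real.log (ω i) / Real.log (ω k)) := by
    intro i
    have h0 : (ω i : ℂ) ≠ 0 := by exact_mod_cast (hω i).ne'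
    rw [Complex.cpow_add _ _ h0, Complex.cpow_one, Complex.re_ofReal_mul,
      Complex.cpow_def_of_ne_zero h0, ← Complex.ofReal_log (hω i).le, ← mul_assoc,
      ← Complex.ofReal_mul, Complex.exp_ofReal_mul_I_re, ht₀, div_eq_mul_inv]
  have hsc : Summable (fun i => (ω i : ℂ) ^ ((1 : ℂ) + (t₀ : ℂ) * Complex.I)) := by
    apply Summable.of_norm
    simpa only [hnorm] using hs
  have hsr : Summable (fun i => ω i * Real.cos (Real.log (ω i) / Real.log (ω k))) := by
    have := Complex.reCLM.summable hsc
    simpa only [Complex.reCLM_apply, hre] using this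
  have hd : Summable (fun i => ω i * (1 - Real.cos (Real.log (ω i) / Real.log (ω k)))) := by
    simpa only [mul_sub, mul_one] using hs.sub hsr
  have hpos : 0 < ∑' i, ω i * (1 - Real.cos (Real.log (ω i) / Real.log (ω k))) := by
    refine hd.tsum_pos (fun i => mul_nonneg (hω i).le ?_) k (mul_pos (hω k) ?_)
    · linarith [Real.cos_le_one (Real.log (ω i) / Real.log (ω k))]
    · rw [div_self hlog]
      have := Real.cos_one_le
      linarith
  refine ⟨by rw [ht₀]; exact inv_ne_zero hlog, fun h => ?_, hpos⟩
  have h2 := congrArg Complex.re h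
  rw [Complex.re_tsum hsc] at h2
  simp only [hre, Complex.one_re] at h2
  have h3 := hs.tsum_sub hsr
  rw [h2, hω1] at h3
  simp only [mul_sub, mul_one] at hpos
  linarith
end
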